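/- Let L be a convex subset and H a closed subset of the graph group G_F. Then LH := {xh : x ∈ L, h ∈ H} is convex, and min(LH) = min(min(L)H), where min denotes the unique minimal element of a convex set with respect to ≤. -/

import Mathlib

open Pointwise

namespace GraphGroupPaper

/-- The set of commutator relators: `gᵢ` and `gⱼ` commute for every pair of distinct
`i, j` with `{i,j} ∉ F`. -/
def Rels (k : ℕ) (F : Set (Sym2 (Fin k))) : Set (FreeGroup (Fin k)) :=
  {w | ∃ i j : Fin k, i ≠ j ∧ s(i, j) ∉ F ∧
      w = FreeGroup.of i * FreeGroup.of j * (FreeGroup.of i)⁻¹ * (FreeGroup.of j)⁻¹}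

/-- The graph group `G_F` with generators `g₁, …, g_k` and relations `gᵢgⱼ = gⱼgᵢ`
for all distinct `i, j` with `{i,j} ∉ F`. -/
abbrev Grp (k : ℕ) (F : Set (Sym2 (Fin k))) := PresentedGroup (Rels k F)

/-- The generator `gᵢ` of the graph group. -/
def gen (k : ℕ) (F : Set (Sym2 (Fin k))) (i : Fin k) : Grp k F :=
  PresentedGroup.of i

/-- The group element corresponding to a symbol: `(i, true)` stands for `gᵢ`,
`(i, false)` stands for `gᵢ⁻¹`. -/
def sym (k : ℕ) (F : Set (Sym2 (Fin k))) (α : Fin k × Bool) : Grp k F :=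
  if α.2 then gen k F α.1 else (gen k F α.1)⁻¹

/-- The product of the word `l` of symbols, as an element of the graph group. -/
def wordProd (k : ℕ) (F : Set (Sym2 (Fin k))) (l : List (Fin k × Bool)) : Grp k F :=
  (l.map (sym k F)).prod

/-- `|x|` : the length of a shortest word in the symbols representing `x`. -/
noncomputable def len {k : ℕ} {F : Set (Sym2 (Fin k))} (x : Grp k F) : ℕ :=
  sInf {n | ∃ l : List (Fin k × Bool), wordProd k F l = x ∧ l.length = n}

/-- The partial order on `G_F`:  `x ≤ y` iff `|y| = |x| + |x⁻¹y|`. -/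
def le {k : ℕ} {F : Set (Sym2 (Fin k))} (x y : Grp k F) : Prop :=
  len y = len x + len (x⁻¹ * y)

/-- `m` is the meet `x ∧ y` (greatest lower bound w.r.t. `le`). -/
def IsMeet {k : ℕ} {F : Set (Sym2 (Fin k))} (x y m : Grp k F) : Prop :=
  le m x ∧ le m y ∧ ∀ w, le w x → le w y → le w m

/-- `j` is the (finite) join `x ∨ y` (least upper bound w.r.t. `le`);
`x ∨ y` is finite iff such a `j` exists. -/
def IsJoin {k : ℕ} {F : Set (Sym2 (Fin k))} (x y j : Grp k F) : Prop :=
  le x j ∧ le y j ∧ ∀ w, le x w → le y w → le j w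

/-- `j` is the (finite) join of the set `S`. -/
def IsJoinSet {k : ℕ} {F : Set (Sym2 (Fin k))} (S : Set (Grp k F)) (j : Grp k F) : Prop :=
  (∀ s ∈ S, le s j) ∧ ∀ w, (∀ s ∈ S, le s w) → le j w

/-- `y` is a segment of `a` if `a = x·y·z` for some `x, z`. -/
def Segment {k : ℕ} {F : Set (Sym2 (Fin k))} (y a : Grp k F) : Prop :=
  ∃ x z, a = x * y * z ∧ len a = len x + len y + len z

/-- The left-invariant metric `dist(x,y) = |x⁻¹y|`. -/
noncomputable def dist {k : ℕ} {F : Set (Sym2 (Fin k))} (x y : Grp k F) : ℕ :=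
  len (x⁻¹ * y)

/-- A nonempty set `L` is convex if `x, z ∈ L` and `dist(x,y) + dist(y,z) = dist(x,z)`
imply `y ∈ L`. -/
def ConvexSet {k : ℕ} {F : Set (Sym2 (Fin k))} (L : Set (Grp k F)) : Prop :=
  L.Nonempty ∧ ∀ x z y : Grp k F, x ∈ L → z ∈ L →
    dist x y + dist y z = dist x z → y ∈ L

/-- An ideal: nonempty, downward closed, and closed under finite joins. -/
def IdealSet {k : ℕ} {F : Set (Sym2 (Fin k))} (I : Set (Grp k F)) : Prop :=
  I.Nonempty ∧ (∀ x ∈ I, ∀ y, le y x → y ∈ I) ∧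
    (∀ x ∈ I, ∀ y ∈ I, ∀ j, IsJoin x y j → j ∈ I)

/-- `H` is closed if both `H` and `H⁻¹` are ideals. -/
def ClosedSet {k : ℕ} {F : Set (Sym2 (Fin k))} (H : Set (Grp k F)) : Prop :=
  IdealSet H ∧ IdealSet H⁻¹

/-- `m` is a minimal element of `S` w.r.t. `le`. -/
def MinimalIn {k : ℕ} {F : Set (Sym2 (Fin k))} (S : Set (Grp k F)) (m : Grp k F) : Prop :=
  m ∈ S ∧ ∀ x ∈ S, le x m → x = m

/-- `l` is a reduced (i.e. shortest) word representing `x`. -/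
def MinWord {k : ℕ} {F : Set (Sym2 (Fin k))} (x : Grp k F) (l : List (Fin k × Bool)) : Prop :=
  wordProd k F l = x ∧ l.length = len x

open Classical in
/-- `#_α(x)`: the number of occurrences of the symbol `α` (not counting `α⁻¹`)
in a reduced word representing `x`. -/
noncomputable def symCount {k : ℕ} {F : Set (Sym2 (Fin k))} (α : Fin k × Bool)
    (x : Grp k F) : ℕ :=
  if h : ∃ l, MinWord x l then h.choose.count α else 0

/-- The symbol `α` occurs in `x`. -/
def Occurs {k : ℕ} {F : Set (Sym2 (Fin k))} (α : Fin k × Bool) (x : Grp k F) : Prop :=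
  0 < symCount α x

/-- `α` is a maximal symbol of `x`, i.e. `xα⁻¹ ≤ x`. -/
def MaxSym {k : ℕ} {F : Set (Sym2 (Fin k))} (α : Fin k × Bool) (x : Grp k F) : Prop :=
  le (x * (sym k F α)⁻¹) x

/-- A peak: an element with precisely one maximal symbol. -/
def IsPeak {k : ℕ} {F : Set (Sym2 (Fin k))} (p : Grp k F) : Prop :=
  ∃! α : Fin k × Bool, MaxSym α p

/-- An `α`-peak: a peak whose unique maximal symbol is `α`. -/
def AlphaPeak {k : ℕ} {F : Set (Sym2 (Fin k))} (α : Fin k × Bool) (p : Grp k F) : Prop :=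
  MaxSym α p ∧ ∀ β, MaxSym β p → β = α

/-- The set of generator indices occurring in `b`. -/
def Support {k : ℕ} {F : Set (Sym2 (Fin k))} (b : Grp k F) : Set (Fin k) :=
  {i | Occurs (i, true) b ∨ Occurs (i, false) b}

/-- `b` is connected: the generators occurring in `b` induce a connected subgraph of
the graph `([k], F)`. -/
def Conn {k : ℕ} {F : Set (Sym2 (Fin k))} (b : Grp k F) : Prop :=
  (SimpleGraph.induce (Support b) (SimpleGraph.fromEdgeSet F)).Connected

/-- `b` is cyclically reduced: `b ∧ b⁻¹ = 1`. -/
def CycRed {k : ℕ} {F : Set (Sym2 (Fin k))} (b : Grp k F) : Prop :=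
  IsMeet b b⁻¹ 1

section GraphGroup

variable {k : ℕ} {F : Set (Sym2 (Fin k))}

section Length

theorem wordProd_cons (α : Fin k × Bool) (l : List (Fin k × Bool)) :
    wordProd k F (α :: l) = sym k F α * wordProd k F l := by
  simp [wordProd]

theorem wordProd_append (l m : List (Fin k × Bool)) :
    wordProd k F (l ++ m) = wordProd k F l * wordProd k F m := by
  simp [wordProd]

theorem sym_flip (α : Fin k × Bool) : sym k F (α.1, !α.2) = (sym k F α)⁻¹ := by
  rcases α with ⟨i, _ | _⟩ <;> simp [sym]

theorem wordProd_flip_reverse (l : List (Fin k × Bool)) :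
    wordProd k F (l.reverse.map fun α => (α.1, !α.2)) = (wordProd k F l)⁻¹ := by
  induction l with
  | nil => simp [wordProd]
  | cons α l ih =>
    rw [List.reverse_cons, List.map_append, wordProd_append, ih, wordProd_cons, mul_inv_rev]
    simp [wordProd, sym_flip]

theorem exists_wordProd_eq (x : Grp k F) : ∃ l, wordProd k F l = x := by
  have hx : x ∈ Subgroup.closure (Set.range (PresentedGroup.of (rels := Rels k F))) := by
    rw [PresentedGroup.closure_range_of]; trivial
  induction hx using Subgroup.closure_induction with
  | mem x hx =>
    obtain ⟨i, rfl⟩ := hx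
    exact ⟨[(i, true)], by simp [wordProd, sym, gen]⟩
  | one => exact ⟨[], rfl⟩
  | mul x y _ _ hx hy =>
    obtain ⟨l, rfl⟩ := hx
    obtain ⟨m, rfl⟩ := hy
    exact ⟨l ++ m, wordProd_append l m⟩
  | inv x _ hx =>
    obtain ⟨l, rfl⟩ := hx
    exact ⟨_, wordProd_flip_reverse l⟩

theorem exists_minWord (x : Grp k F) : ∃ l, MinWord x l := by
  obtain ⟨l, hl⟩ := exists_wordProd_eq x
  exact Nat.sInf_mem (s := {n | ∃ l, wordProd k F l = x ∧ l.length = n}) ⟨_, l, hl, rfl⟩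

theorem len_wordProd_le (l : List (Fin k × Bool)) : len (wordProd k F l) ≤ l.length :=
  Nat.sInf_le ⟨l, rfl, rfl⟩

theorem len_one : len (1 : Grp k F) = 0 :=
  Nat.le_zero.1 (len_wordProd_le (F := F) [])

theorem eq_one_of_len {x : Grp k F} (h : len x = 0) : x = 1 := by
  obtain ⟨l, rfl, hl⟩ := exists_minWord x
  rw [h, List.length_eq_zero_iff] at hl
  rw [hl]; rfl

theorem len_mul_le (x y : Grp k F) : len (x * y) ≤ len x + len y := by
  obtain ⟨l, hx, hl⟩ := exists_minWord x
  obtain ⟨m, hy, hm⟩ := exists_minWord y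
  have := len_wordProd_le (F := F) (l ++ m)
  rwa [wordProd_append, hx, hy, List.length_append, hl, hm] at this

theorem len_inv_le (x : Grp k F) : len x⁻¹ ≤ len x := by
  obtain ⟨l, hx, hl⟩ := exists_minWord x
  have := len_wordProd_le (F := F) (l.reverse.map fun α => (α.1, !α.2))
  rw [wordProd_flip_reverse, hx] at this
  simpa [hl] using this

theorem len_inv (x : Grp k F) : len x⁻¹ = len x :=
  le_antisymm (len_inv_le x) (by simpa using len_inv_le x⁻¹)

/-- The homomorphism to `ℤ/2` sending every generator to `1`. -/
def parity : Grp k F →* Multiplicative (ZMod 2) :=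
  PresentedGroup.toGroup (f := fun _ => Multiplicative.ofAdd 1) (by
    rintro _ ⟨i, j, -, -, rfl⟩
    simp)

theorem parity_wordProd (l : List (Fin k × Bool)) :
    parity (wordProd k F l) = Multiplicative.ofAdd (l.length : ZMod 2) := by
  induction l with
  | nil => simp [wordProd]
  | cons α l ih =>
    have h : parity (sym k F α) = Multiplicative.ofAdd 1 := by
      rcases α with ⟨i, _ | _⟩ <;> simp [sym, gen, parity]; decide
    rw [wordProd_cons, map_mul, ih, h, List.length_cons, ← ofAdd_add]
    push_cast
    rw [add_comm]

theorem parity_eq (x : Grp k F) : parity x = Multiplicative.ofAdd (len x : ZMod 2) := by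
  obtain ⟨l, rfl, hl⟩ := exists_minWord x
  rw [parity_wordProd, hl]

theorem len_wordProd_mod_two (l : List (Fin k × Bool)) :
    len (wordProd k F l) % 2 = l.length % 2 := by
  have h := parity_eq (wordProd k F l)
  rw [parity_wordProd] at h
  exact ((ZMod.natCast_eq_natCast_iff' _ _ 2).1 (Multiplicative.ofAdd.injective h)).symm

theorem len_sym (α : Fin k × Bool) : len (sym k F α) = 1 := by
  have h₁ := len_wordProd_le (F := F) [α]
  have h₂ := len_wordProd_mod_two (F := F) [α]
  simp [wordProd] at h₁ h₂
  omega

theorem len_sym_mul (α : Fin k × Bool) (x : Grp k F) :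
    len (sym k F α * x) = len x + 1 ∨ len x = len (sym k F α * x) + 1 := by
  obtain ⟨l, rfl, hl⟩ := exists_minWord x
  have h₁ := len_wordProd_mod_two (F := F) (α :: l)
  have h₂ := len_mul_le (sym k F α) (wordProd k F l)
  have h₃ := len_mul_le (sym k F α)⁻¹ (sym k F α * wordProd k F l)
  rw [inv_mul_cancel_left, len_inv] at h₃
  rw [len_sym] at h₂ h₃
  rw [wordProd_cons, List.length_cons] at h₁
  omega

end Length

section Exchange

/-- The subgroup generated by the generators with index in `J`. -/
def parabolic (F : Set (Sym2 (Fin k))) (J : Set (Fin k)) : Subgroup (Grp k F) :=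
  Subgroup.closure (gen k F '' J)

/-- The indices of the generators other than `gᵢ` that commute with `gᵢ`. -/
def link (F : Set (Sym2 (Fin k))) (i : Fin k) : Set (Fin k) :=
  {j | i ≠ j ∧ s(i, j) ∉ F}

theorem gen_commute {i j : Fin k} (h : i ≠ j) (hF : s(i, j) ∉ F) :
    Commute (gen k F i) (gen k F j) := by
  have h₁ : PresentedGroup.mk (Rels k F) (FreeGroup.of i * FreeGroup.of j *
      (FreeGroup.of i)⁻¹ * (FreeGroup.of j)⁻¹) = 1 :=
    PresentedGroup.one_of_mem ⟨i, j, h, hF, rfl⟩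
  have h₂ : gen k F i * gen k F j * (gen k F i)⁻¹ * (gen k F j)⁻¹ = 1 := by
    simp only [map_mul, map_inv] at h₁
    exact h₁
  rw [mul_inv_eq_one, mul_inv_eq_iff_eq_mul] at h₂
  exact h₂

theorem lift_rels {M : Type*} [Group M] (f : Fin k → M)
    (h : ∀ i j, i ≠ j → s(i, j) ∉ F → Commute (f i) (f j)) :
    ∀ r ∈ Rels k F, FreeGroup.lift f r = 1 := by
  rintro _ ⟨i, j, hij, hF, rfl⟩
  simp [(h i j hij hF).eq]

open Classical in
/-- The retraction of the graph group onto `parabolic F J`. -/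
noncomputable def retract (F : Set (Sym2 (Fin k))) (J : Set (Fin k)) : Grp k F →* Grp k F :=
  PresentedGroup.toGroup (f := fun j => if j ∈ J then gen k F j else 1) <|
    lift_rels _ fun i j hij hF => by
      split_ifs
      exacts [gen_commute hij hF, Commute.one_right _, Commute.one_left _, Commute.one_left _]

open Classical in
theorem retract_sym (J : Set (Fin k)) (α : Fin k × Bool) :
    retract F J (sym k F α) = if α.1 ∈ J then sym k F α else 1 := by
  rcases α with ⟨i, _ | _⟩ <;> by_cases h : i ∈ J <;> simp [sym, gen, retract, h]

open Classical in
theorem retract_wordProd (J : Set (Fin k)) (l : List (Fin k × Bool)) :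
    retract F J (wordProd k F l) = wordProd k F (l.filter fun α => α.1 ∈ J) := by
  induction l with
  | nil => simp [wordProd]
  | cons α l ih =>
    by_cases h : α.1 ∈ J <;> simp [wordProd_cons, retract_sym, ih, h]

theorem retract_of_mem {J : Set (Fin k)} {x : Grp k F} (hx : x ∈ parabolic F J) :
    retract F J x = x := by
  induction hx using Subgroup.closure_induction with
  | mem x hx =>
    obtain ⟨i, hi, rfl⟩ := hx
    simp [gen, retract, hi]
  | one => simp
  | mul x y _ _ hx hy => rw [map_mul, hx, hy]
  | inv x _ hx => rw [map_inv, hx]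

/-- A reduced word representing an element of a parabolic subgroup only uses its generators. -/
theorem MinWord.mem_of_mem_parabolic {J : Set (Fin k)} {x : Grp k F} {l : List (Fin k × Bool)}
    (hl : MinWord x l) (hx : x ∈ parabolic F J) : ∀ α ∈ l, α.1 ∈ J := by
  classical
  have h := retract_of_mem hx
  rw [← hl.1, retract_wordProd] at h
  have h' := len_wordProd_le (F := F) (l.filter fun α => α.1 ∈ J)
  rw [h, hl.1, ← hl.2] at h'
  have := List.length_filter_eq_length_iff.1 (le_antisymm (List.length_filter_le _ _) h')
  simpa using this

theorem MinWord.append_left {x : Grp k F} {l m : List (Fin k × Bool)}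
    (h : MinWord x (l ++ m)) : MinWord (wordProd k F l) l := by
  refine ⟨rfl, le_antisymm ?_ (len_wordProd_le l)⟩
  have h₁ := len_mul_le (wordProd k F l) (wordProd k F m)
  have h₂ := len_wordProd_le (F := F) m
  have h₃ := h.2
  rw [← wordProd_append, h.1] at h₁
  rw [List.length_append] at h₃
  omega

theorem MinWord.tail {x : Grp k F} {α : Fin k × Bool} {l : List (Fin k × Bool)}
    (h : MinWord x (α :: l)) : MinWord (wordProd k F l) l := by
  refine ⟨rfl, le_antisymm ?_ (len_wordProd_le l)⟩
  have h₁ := len_mul_le (sym k F α) (wordProd k F l)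
  have h₃ := h.2
  rw [← wordProd_cons, h.1, len_sym] at h₁
  rw [List.length_cons] at h₃
  omega

/-- Left translation of integer-valued functions on the graph group. -/
def shift (F : Set (Sym2 (Fin k))) : Grp k F →* Equiv.Perm (Grp k F → ℤ) where
  toFun x :=
    { toFun := fun f g => f (x⁻¹ * g)
      invFun := fun f g => f (x * g)
      left_inv := fun f => by simp
      right_inv := fun f => by simp }
  map_one' := by ext; simp
  map_mul' x y := by ext; simp [mul_assoc]

open Classical in
/-- The translation by the symbol `α`, followed by addition of the indicator function of the
stabilizer of the wall crossed by the edge from `1` to `α`. -/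
noncomputable def cross (F : Set (Sym2 (Fin k))) (α : Fin k × Bool) :
    Equiv.Perm (Grp k F → ℤ) where
  toFun f g := (if g ∈ parabolic F (link F α.1) then 1 else 0) + f ((sym k F α)⁻¹ * g)
  invFun f g := f (sym k F α * g) -
    (if sym k F α * g ∈ parabolic F (link F α.1) then 1 else 0)
  left_inv f := by simp
  right_inv f := by simp

theorem sym_commute {α β : Fin k × Bool} (h : β.1 ∈ link F α.1) :
    Commute (sym k F α) (sym k F β) := by
  have := gen_commute h.1 h.2
  unfold sym
  split_ifs <;> simpa using this

theorem cross_commute_shift {α : Fin k × Bool} {j : Fin k} (hj : j ∈ link F α.1) :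
    Commute (cross F α) (shift F (gen k F j)) := by
  have h : Commute (sym k F α)⁻¹ (gen k F j)⁻¹ :=
    ((sym_commute (α := α) (β := (j, true)) hj)).inv_inv
  have hZ : (gen k F j)⁻¹ ∈ parabolic F (link F α.1) :=
    inv_mem (Subgroup.subset_closure ⟨j, hj, rfl⟩)
  ext f g
  have hg := Subgroup.mul_mem_cancel_left (parabolic F (link F α.1)) hZ (y := g)
  simp only [cross, shift, Equiv.Perm.mul_apply, Equiv.coe_fn_mk, MonoidHom.coe_mk, OneHom.coe_mk,
    ← mul_assoc, h.eq]
  congr 2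
  exact propext hg.symm

/-- The affine action of the graph group on integer-valued functions whose cocycle counts, with
signs, the crossings of the wall of the edge from `1` to `α` and of its translates. -/
noncomputable def wallHom (F : Set (Sym2 (Fin k))) (α : Fin k × Bool) :
    Grp k F →* Equiv.Perm (Grp k F → ℤ) :=
  PresentedGroup.toGroup (f := fun j => if j = α.1 then
      (if α.2 then cross F α else (cross F α)⁻¹) else shift F (gen k F j)) <|
    lift_rels _ fun i j hij hF => by
      by_cases hi : i = α.1
      · have hj : j ∈ link F α.1 := hi ▸ ⟨hij, hF⟩
        rw [if_pos hi, if_neg (Ne.symm hj.1)]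
        split_ifs
        exacts [cross_commute_shift hj, (cross_commute_shift hj).inv_left]
      · rw [if_neg hi]
        by_cases hj : j = α.1
        · have hi : i ∈ link F α.1 := hj ▸ ⟨hij.symm, Sym2.eq_swap ▸ hF⟩
          rw [if_pos hj]
          split_ifs
          exacts [(cross_commute_shift hi).symm, (cross_commute_shift hi).symm.inv_right]
        · rw [if_neg hj]
          exact (gen_commute hij hF).map (shift F)

theorem wallHom_self (α : Fin k × Bool) : wallHom F α (sym k F α) = cross F α := by
  rcases α with ⟨i, _ | _⟩ <;> simp [sym, gen, wallHom]

theorem wallHom_of_ne {α β : Fin k × Bool} (h : β.1 ≠ α.1) :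
    wallHom F α (sym k F β) = shift F (sym k F β) := by
  rcases β with ⟨i, _ | _⟩ <;> simp_all [sym, gen, wallHom]

theorem eq_or_flip_of_fst_eq {α β : Fin k × Bool} (h : β.1 = α.1) :
    β = α ∨ β = (α.1, !α.2) := by
  rcases α with ⟨i, _ | _⟩ <;> rcases β with ⟨j, _ | _⟩ <;> simp_all

/-- If the cocycle of a word does not vanish at `g`, some letter of the word crosses the wall
of `g`. -/
theorem exists_crossing {α : Fin k × Bool} (l : List (Fin k × Bool)) (g : Grp k F)
    (h : wallHom F α (wordProd k F l) 0 g ≠ 0) :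
    ∃ l₁ β l₂, l = l₁ ++ β :: l₂ ∧
      ((β = α ∧ (wordProd k F l₁)⁻¹ * g ∈ parabolic F (link F α.1)) ∨
        (β = (α.1, !α.2) ∧
          sym k F α * ((wordProd k F l₁)⁻¹ * g) ∈ parabolic F (link F α.1))) := by
  induction l generalizing g with
  | nil => simp [wordProd] at h
  | cons β l ih =>
    by_cases hg : (β = α ∧ g ∈ parabolic F (link F α.1)) ∨
        (β = (α.1, !α.2) ∧ sym k F α * g ∈ parabolic F (link F α.1))
    · exact ⟨[], β, l, rfl, by simpa [wordProd] using hg⟩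
    · have h' : wallHom F α (wordProd k F l) 0 ((sym k F β)⁻¹ * g) ≠ 0 := by
        rw [wordProd_cons, map_mul, Equiv.Perm.mul_apply] at h
        by_cases hβ : β.1 = α.1
        · obtain rfl | rfl := eq_or_flip_of_fst_eq hβ
          · have hg' : g ∉ parabolic F (link F β.1) := fun hZ => hg (Or.inl ⟨rfl, hZ⟩)
            rw [wallHom_self] at h
            simpa only [cross, Equiv.coe_fn_mk, if_neg hg', zero_add] using h
          · have hg' : sym k F α * g ∉ parabolic F (link F α.1) := fun hZ =>
              hg (Or.inr ⟨rfl, hZ⟩)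
            rw [sym_flip, map_inv, wallHom_self] at h
            rw [sym_flip, inv_inv]
            simpa only [cross, Equiv.Perm.inv_def, Equiv.symm, Equiv.coe_fn_mk, if_neg hg',
              sub_zero] using h
        · rw [wallHom_of_ne hβ] at h
          exact h
      obtain ⟨l₁, γ, l₂, rfl, hγ⟩ := ih _ h'
      exact ⟨β :: l₁, γ, l₂, rfl, by simpa [wordProd_cons, mul_assoc] using hγ⟩

/-- A symbol `α` that is initial in `x` can be moved to the front of any reduced word of `x`. -/
theorem MinWord.exchange {x : Grp k F} {α : Fin k × Bool} {l : List (Fin k × Bool)}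
    (hl : MinWord x l) (hα : len x = len ((sym k F α)⁻¹ * x) + 1) :
    ∃ l₁ l₂, l = l₁ ++ α :: l₂ ∧ ∀ β ∈ l₁, β.1 ∈ link F α.1 := by
  obtain ⟨r, hr, hrl⟩ := exists_minWord ((sym k F α)⁻¹ * x)
  have hx : MinWord x (α :: r) :=
    ⟨by rw [wordProd_cons, hr, mul_inv_cancel_left], by rw [List.length_cons, hrl, hα]⟩
  have not_mem : ∀ (m : List (Fin k × Bool)) β, MinWord (wordProd k F m) m → β ∈ m →
      β.1 = α.1 → wordProd k F m ∉ parabolic F (link F α.1) := fun m β hm hβ h hZ =>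
    (hm.mem_of_mem_parabolic hZ β hβ).1 h.symm
  have h₀ : wallHom F α (wordProd k F r) 0 (sym k F α)⁻¹ = 0 := by
    by_contra hr₀
    obtain ⟨r₁, β, r₂, rfl, ⟨rfl, h⟩ | ⟨rfl, h⟩⟩ := exists_crossing r _ hr₀
    · refine not_mem (β :: r₁) β (MinWord.append_left (m := β :: r₂) hx) (by simp) rfl ?_
      rw [← inv_mem_iff, wordProd_cons, mul_inv_rev]
      exact h
    · refine not_mem (α :: (r₁ ++ [(α.1, !α.2)])) α
        (MinWord.append_left (m := r₂) (by simpa using hx)) (by simp) rfl ?_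
      rw [← inv_mem_iff]
      simpa [wordProd_cons, wordProd_append, sym_flip, wordProd, mul_assoc] using h
  have h₁ : wallHom F α (wordProd k F l) 0 1 ≠ 0 := by
    rw [hl.1, ← hx.1, wordProd_cons, map_mul, Equiv.Perm.mul_apply, wallHom_self]
    simp [cross, h₀, one_mem]
  obtain ⟨l₁, β, l₂, rfl, ⟨rfl, h⟩ | ⟨rfl, h⟩⟩ := exists_crossing l _ h₁
  · refine ⟨l₁, l₂, rfl, (hl.append_left).mem_of_mem_parabolic ?_⟩
    simpa using h
  · refine (not_mem (l₁ ++ [(α.1, !α.2)]) (α.1, !α.2)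
      (MinWord.append_left (m := l₂) (by simpa using hl)) (by simp) rfl ?_).elim
    rw [← inv_mem_iff]
    simpa [wordProd_append, sym_flip, wordProd] using h

end Exchange

section Order

theorem len_le_add (a x : Grp k F) : len x ≤ len a + len (a⁻¹ * x) := by
  simpa using len_mul_le a (a⁻¹ * x)

theorem le_of_len_add_le {a x : Grp k F} (h : len a + len (a⁻¹ * x) ≤ len x) : le a x :=
  le_antisymm (len_le_add a x) h

theorem one_le (x : Grp k F) : le 1 x := by
  simp [le, len_one]

theorem le_mul_of_le {a c x : Grp k F} (ha : le a x) (hc : le c (a⁻¹ * x)) :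
    len (a * c) = len a + len c ∧ le (a * c) x := by
  have h₁ := len_mul_le a c
  have h₂ := len_le_add (a * c) x
  unfold le at *
  rw [mul_inv_rev, mul_assoc] at *
  omega

theorem le_inv_mul_of_mul_le {a c x : Grp k F} (h : le (a * c) x)
    (hac : len (a * c) = len a + len c) : le c (a⁻¹ * x) := by
  have h₁ := len_le_add a x
  apply le_of_len_add_le
  unfold le at h
  rw [mul_inv_rev, mul_assoc] at h
  omega

theorem le_of_mul_le {a c x : Grp k F} (h : le (a * c) x)
    (hac : len (a * c) = len a + len c) : le a x := by
  have h₁ := len_le_add c (a⁻¹ * x)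
  apply le_of_len_add_le
  unfold le at h
  rw [mul_inv_rev, mul_assoc] at h
  omega

theorem inv_mul_le_inv_mul {a b x : Grp k F} (hab : le a b) (hbx : le b x) :
    le (a⁻¹ * b) (a⁻¹ * x) :=
  le_inv_mul_of_mul_le (by simpa using hbx) (by simpa [le] using hab)

theorem exists_sym_le {x : Grp k F} (hx : x ≠ 1) : ∃ α, le (sym k F α) x := by
  obtain ⟨_ | ⟨α, l⟩, hl⟩ := exists_minWord x
  · exact (hx (by simpa [wordProd] using hl.1.symm)).elim
  · refine ⟨α, ?_⟩
    have h₁ := hl.tail.2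
    have h₂ := hl.2
    rw [List.length_cons] at h₂
    rw [le, ← hl.1, wordProd_cons, inv_mul_cancel_left, ← wordProd_cons, hl.1, ← h₁, len_sym]
    omega

theorem sym_commute_wordProd {α : Fin k × Bool} {l : List (Fin k × Bool)}
    (h : ∀ β ∈ l, β.1 ∈ link F α.1) : Commute (sym k F α) (wordProd k F l) := by
  induction l with
  | nil => exact Commute.one_right _
  | cons β l ih =>
    rw [wordProd_cons]
    exact (sym_commute (h β (by simp))).mul_right (ih fun γ hγ => h γ (by simp [hγ]))

/-- Two distinct initial symbols of an element commute, and their product is again initial. -/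
theorem sym_commute_of_le {α β : Fin k × Bool} {x : Grp k F} (hne : α ≠ β)
    (hα : le (sym k F α) x) (hβ : le (sym k F β) x) :
    Commute (sym k F α) (sym k F β) ∧ le (sym k F β) ((sym k F α)⁻¹ * x) := by
  obtain ⟨l, hl, hll⟩ := exists_minWord ((sym k F α)⁻¹ * x)
  unfold le at hα hβ
  rw [len_sym] at hα hβ
  have hx : MinWord x (α :: l) :=
    ⟨by rw [wordProd_cons, hl, mul_inv_cancel_left], by rw [List.length_cons, hll]; omega⟩
  obtain ⟨_ | ⟨γ, l₁⟩, l₂, h, h'⟩ := hx.exchange (α := β) (by omega)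
  · rw [List.nil_append, List.cons.injEq] at h
    exact (hne h.1).elim
  · rw [List.cons_append, List.cons.injEq] at h
    obtain ⟨rfl, rfl⟩ := h
    refine ⟨(sym_commute (h' α (by simp))).symm, le_of_len_add_le ?_⟩
    have hc := sym_commute_wordProd (α := β) (l := l₁) fun δ hδ => h' δ (by simp [hδ])
    have h₁ := len_wordProd_le (F := F) (l₁ ++ l₂)
    rw [len_sym, ← hll, ← hl, wordProd_append, wordProd_cons, ← mul_assoc, hc.inv_left.eq,
      mul_assoc, inv_mul_cancel_left, ← wordProd_append]
    simp only [List.length_append, List.length_cons] at *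
    omega

theorem sym_commute_of_disjoint {α : Fin k × Bool} {b x : Grp k F} (hα : le (sym k F α) x)
    (hb : le b x) (hd : 1 + len b ≤ len ((sym k F α)⁻¹ * b)) :
    Commute (sym k F α) b ∧ le b ((sym k F α)⁻¹ * x) := by
  obtain ⟨n, hn⟩ : ∃ n, len b = n := ⟨_, rfl⟩
  induction n generalizing b x with
  | zero =>
    obtain rfl := eq_one_of_len hn
    exact ⟨Commute.one_right _, one_le _⟩
  | succ n ih =>
    obtain ⟨β, hβ⟩ : ∃ β, le (sym k F β) b := by
      apply exists_sym_le
      rintro rfl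
      simp [len_one] at hn
    obtain ⟨c, rfl⟩ : ∃ c, b = sym k F β * c := ⟨_, (mul_inv_cancel_left _ _).symm⟩
    have hlen : len (sym k F β * c) = len (sym k F β) + len c := by simpa [le] using hβ
    have hne : α ≠ β := by
      rintro rfl
      rw [inv_mul_cancel_left] at hd
      omega
    obtain ⟨hcomm, hle⟩ := sym_commute_of_le hne hα (le_of_mul_le hb hlen)
    obtain ⟨-, hle'⟩ := sym_commute_of_le hne.symm (le_of_mul_le hb hlen) hα
    have h₁ : (sym k F α)⁻¹ * (sym k F β * c) = sym k F β * ((sym k F α)⁻¹ * c) := by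
      rw [← mul_assoc, hcomm.inv_left.eq, mul_assoc]
    have h₂ := len_mul_le (sym k F β) ((sym k F α)⁻¹ * c)
    rw [← h₁] at h₂
    have h₃ := len_sym (F := F) β
    obtain ⟨ihc, ihle⟩ := ih hle' (le_inv_mul_of_mul_le hb hlen) (by omega) (by omega)
    refine ⟨hcomm.mul_right ihc, (le_mul_of_le hle ?_).2⟩
    rwa [← mul_assoc, hcomm.inv_inv.symm.eq, mul_assoc]

/-- Elements with a common upper bound and no common initial part commute. -/
theorem commute_of_disjoint {a b x : Grp k F} (ha : le a x) (hb : le b x)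
    (hd : len a + len b ≤ len (a⁻¹ * b)) : Commute a b ∧ le b (a⁻¹ * x) := by
  obtain ⟨n, hn⟩ : ∃ n, len a = n := ⟨_, rfl⟩
  induction n generalizing a x with
  | zero =>
    obtain rfl := eq_one_of_len hn
    exact ⟨Commute.one_left _, by simpa using hb⟩
  | succ n ih =>
    obtain ⟨α, hα⟩ : ∃ α, le (sym k F α) a := by
      apply exists_sym_le
      rintro rfl
      simp [len_one] at hn
    obtain ⟨c, rfl⟩ : ∃ c, a = sym k F α * c := ⟨_, (mul_inv_cancel_left _ _).symm⟩
    have hlen : len (sym k F α * c) = len (sym k F α) + len c := by simpa [le] using hα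
    have h₁ := len_mul_le c⁻¹ ((sym k F α)⁻¹ * b)
    rw [mul_inv_rev, mul_assoc] at hd
    rw [len_inv] at h₁
    have h₃ := len_sym (F := F) α
    obtain ⟨hcomm, hle⟩ := sym_commute_of_disjoint (le_of_mul_le ha hlen) hb (by omega)
    have h₂ := len_mul_le (c⁻¹ * b) (sym k F α)⁻¹
    rw [mul_assoc, ← hcomm.inv_left.eq, len_inv] at h₂
    obtain ⟨ihc, ihle⟩ := ih (le_inv_mul_of_mul_le ha hlen) hle (by omega) (by omega)
    exact ⟨hcomm.mul_left ihc, by rwa [mul_inv_rev, mul_assoc]⟩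

theorem exists_common_sym {u v : Grp k F} (h : len (u⁻¹ * v) < len u + len v) :
    ∃ α, le (sym k F α) u ∧ le (sym k F α) v := by
  obtain ⟨n, hn⟩ : ∃ n, len u = n := ⟨_, rfl⟩
  induction n generalizing u v with
  | zero =>
    obtain rfl := eq_one_of_len hn
    simp [len_one] at h
  | succ n ih =>
    obtain ⟨α, hα⟩ : ∃ α, le (sym k F α) u := by
      apply exists_sym_le
      rintro rfl
      simp [len_one] at hn
    by_cases hv : le (sym k F α) v
    · exact ⟨α, hα, hv⟩
    have hα' := hα
    unfold le at hα' hv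
    rw [len_sym] at hα' hv
    have hv' := len_sym_mul (α.1, !α.2) v
    rw [sym_flip] at hv'
    have heq : ((sym k F α)⁻¹ * u)⁻¹ * ((sym k F α)⁻¹ * v) = u⁻¹ * v := by group
    obtain ⟨β, hβu, hβv⟩ := ih (u := (sym k F α)⁻¹ * u) (v := (sym k F α)⁻¹ * v)
      (by rw [heq]; omega) (by omega)
    have hne : (α.1, !α.2) ≠ β := by
      rintro rfl
      unfold le at hβu
      rw [len_sym, sym_flip, inv_inv, mul_inv_cancel_left] at hβu
      omega
    have hle : le (sym k F (α.1, !α.2)) ((sym k F α)⁻¹ * v) := by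
      apply le_of_len_add_le
      rw [len_sym, sym_flip, inv_inv, mul_inv_cancel_left]
      omega
    obtain ⟨hcomm, hβ⟩ := sym_commute_of_le hne hle hβv
    rw [sym_flip, inv_inv, mul_inv_cancel_left] at hβ
    rw [sym_flip, Commute.inv_left_iff] at hcomm
    obtain ⟨h₁, h₂⟩ := le_mul_of_le hα hβu
    rw [hcomm.eq, add_comm] at h₁
    rw [hcomm.eq] at h₂
    exact ⟨β, le_of_mul_le h₂ h₁, hβ⟩

theorem exists_meet (x y : Grp k F) :
    ∃ m, le m x ∧ le m y ∧ len (x⁻¹ * y) = len (m⁻¹ * x) + len (m⁻¹ * y) := by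
  obtain ⟨n, hn⟩ : ∃ n, len x = n := ⟨_, rfl⟩
  induction n using Nat.strong_induction_on generalizing x y with
  | _ n ih =>
    by_cases h : len (x⁻¹ * y) < len x + len y
    · obtain ⟨α, hx, hy⟩ := exists_common_sym h
      have hx' := hx
      unfold le at hx'
      rw [len_sym] at hx'
      obtain ⟨m, hmx, hmy, hm⟩ := ih (len ((sym k F α)⁻¹ * x)) (by omega) ((sym k F α)⁻¹ * x)
        ((sym k F α)⁻¹ * y) rfl
      refine ⟨sym k F α * m, (le_mul_of_le hx hmx).2, (le_mul_of_le hy hmy).2, ?_⟩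
      have heq : ((sym k F α)⁻¹ * x)⁻¹ * ((sym k F α)⁻¹ * y) = x⁻¹ * y := by group
      rwa [heq, ← mul_assoc, ← mul_assoc, ← mul_inv_rev] at hm
    · have h₁ := len_mul_le x⁻¹ y
      rw [len_inv] at h₁
      exact ⟨1, one_le x, one_le y, by simp; omega⟩

theorem le_meet {m v x y : Grp k F} (hmx : le m x) (hmy : le m y)
    (hm : len (x⁻¹ * y) = len (m⁻¹ * x) + len (m⁻¹ * y)) (hvx : le v x) (hvy : le v y) :
    le v m := by
  obtain ⟨c, hcv, hcm, hc⟩ := exists_meet v m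
  have heq : (c⁻¹ * m)⁻¹ * (c⁻¹ * v) = (v⁻¹ * m)⁻¹ := by group
  have key : ∀ z, le m z → le v z → le (c⁻¹ * v) (m⁻¹ * z) := by
    intro z hmz hvz
    have h := (commute_of_disjoint (inv_mul_le_inv_mul hcm hmz) (inv_mul_le_inv_mul hcv hvz)
      (by rw [heq, len_inv]; omega)).2
    rwa [mul_inv_rev, inv_inv, mul_assoc, mul_inv_cancel_left] at h
  have hx := key x hmx hvx
  have hy := key y hmy hvy
  have h₁ := len_mul_le ((c⁻¹ * v)⁻¹ * (m⁻¹ * x))⁻¹ ((c⁻¹ * v)⁻¹ * (m⁻¹ * y))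
  have heq' : ((c⁻¹ * v)⁻¹ * (m⁻¹ * x))⁻¹ * ((c⁻¹ * v)⁻¹ * (m⁻¹ * y)) = x⁻¹ * y := by group
  rw [heq', len_inv] at h₁
  unfold le at hx hy
  have hcv' : c⁻¹ * v = 1 := eq_one_of_len (by omega)
  rwa [← inv_mul_eq_one.1 hcv']

end Order

section Metric

/-- `y` lies on a geodesic from `x` to `z`. -/
def Between (x y z : Grp k F) : Prop :=
  dist x y + dist y z = dist x z

theorem dist_comm (x y : Grp k F) : dist x y = dist y x := by
  rw [dist, dist, ← len_inv, mul_inv_rev, inv_inv]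

theorem dist_self (x : Grp k F) : dist x x = 0 := by
  simp [dist, len_one]

theorem eq_of_dist_eq_zero {x y : Grp k F} (h : dist x y = 0) : x = y :=
  inv_mul_eq_one.1 (eq_one_of_len h)

theorem dist_triangle (x y z : Grp k F) : dist x z ≤ dist x y + dist y z := by
  simpa [dist, mul_assoc] using len_mul_le (x⁻¹ * y) (y⁻¹ * z)

theorem dist_mul_left (p x y : Grp k F) : dist (p * x) (p * y) = dist x y := by
  simp [dist, mul_assoc]

theorem between_mul_left (p : Grp k F) {x y z : Grp k F} :
    Between (p * x) (p * y) (p * z) ↔ Between x y z := by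
  simp only [Between, dist_mul_left]

theorem Between.symm {x y z : Grp k F} (h : Between x y z) : Between z y x := by
  unfold Between at *
  rw [dist_comm z y, dist_comm y x, dist_comm z x]
  omega

theorem le_iff_between {x y : Grp k F} : le x y ↔ Between 1 x y := by
  simp [le, Between, dist, eq_comm]

theorem le_inv_mul_iff_between {p x y : Grp k F} :
    le (p⁻¹ * x) (p⁻¹ * y) ↔ Between p x y := by
  rw [le_iff_between, ← between_mul_left p]
  simp

theorem Between.right_trans {x u m y : Grp k F} (hm : Between x m y) (hu : Between m u y) :
    Between x u y ∧ Between x m u := by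
  have h₁ := dist_triangle x m u
  have h₂ := dist_triangle x u y
  unfold Between at *
  omega

/-- Any three elements of a graph group have a median. -/
theorem exists_median (p x y : Grp k F) :
    ∃ m, Between p m x ∧ Between p m y ∧ Between x m y := by
  obtain ⟨m, hx, hy, h⟩ := exists_meet (p⁻¹ * x) (p⁻¹ * y)
  refine ⟨p * m, ?_, ?_, ?_⟩
  · rw [← le_inv_mul_iff_between]; simpa using hx
  · rw [← le_inv_mul_iff_between]; simpa using hy
  · unfold Between
    rw [dist_comm x]
    simpa [dist, mul_assoc] using h.symm

theorem isJoin_of_between {y y₁ y₂ m₁ m₂ : Grp k F} (h₁ : le m₁ y) (h₂ : le m₂ y)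
    (h₁' : Between y₁ m₁ y) (h₂' : Between y₂ m₂ y) (hy : Between y₁ y y₂) :
    IsJoin m₁ m₂ y := by
  refine ⟨h₁, h₂, fun w hw₁ hw₂ => ?_⟩
  obtain ⟨u, huy, huw, hu⟩ := exists_meet y w
  have key : ∀ m z, le m y → le m w → Between z m y → Between z u y := by
    intro m z hmy hmw hz
    refine (hz.right_trans ?_).1
    rw [← le_inv_mul_iff_between]
    exact inv_mul_le_inv_mul (le_meet huy huw hu hmy hmw) huy
  have hu₁ := key m₁ y₁ h₁ hw₁ h₁'
  have hu₂ := (key m₂ y₂ h₂ hw₂ h₂').symm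
  have h₃ := dist_triangle y₁ u y₂
  have h₄ := dist_comm u y
  unfold Between at *
  obtain rfl : u = y := eq_of_dist_eq_zero (by omega)
  exact huw

/-- Every element has a gate in a convex set. -/
theorem ConvexSet.exists_gate {L : Set (Grp k F)} (hL : ConvexSet L) (y : Grp k F) :
    ∃ p ∈ L, ∀ x ∈ L, Between x p y := by
  classical
  obtain ⟨p, hp, hmin⟩ := exists_minimalFor_of_wellFoundedLT (· ∈ L) (fun x => dist x y) hL.1
  refine ⟨p, hp, fun x hx => ?_⟩
  obtain ⟨m, hmx, hmy, hxy⟩ := exists_median p x y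
  have h := hmin (hL.2 p x m hp hx hmx)
  have : p = m := by
    apply eq_of_dist_eq_zero
    unfold Between at hmy
    by_contra h0
    have := h (by dsimp only; omega)
    dsimp only at this
    omega
  rwa [this]

/-- If `p` and `q` are gates of `a` and `x`, then the part of `p⁻¹x` below `p⁻¹a` is parallel to
an initial part of `q⁻¹x`. -/
theorem le_of_gates {p q a x m : Grp k F} (hp : Between q p a) (hq : Between p q x)
    (hma : Between p m a) (hmx : Between p m x) : le (p⁻¹ * m) (q⁻¹ * x) := by
  have h := (hp.right_trans hma).2
  have h₁ := (commute_of_disjoint (le_inv_mul_iff_between.2 hq) (le_inv_mul_iff_between.2 hmx) (by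
    unfold Between at h
    rw [dist_comm q p] at h
    simpa [dist, mul_assoc] using h.le)).2
  simpa [mul_assoc] using h₁

theorem ClosedSet.gate_mem {H : Set (Grp k F)} (hH : ClosedSet H) {x q y : Grp k F}
    (hxy : x⁻¹ * y ∈ H) (hq : Between x q y) : q⁻¹ * y ∈ H := by
  have h := hH.2.2.1 (y⁻¹ * x) (by simpa using hxy) (y⁻¹ * q) (le_inv_mul_iff_between.2 hq.symm)
  simpa using h

theorem exists_gate_of_mem_mul {L H : Set (Grp k F)} (hL : ConvexSet L) (hH : ClosedSet H)
    {y : Grp k F} (hy : y ∈ L * H) : ∃ q ∈ L, q⁻¹ * y ∈ H ∧ ∀ x ∈ L, Between x q y := by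
  obtain ⟨x, hx, h, hh, rfl⟩ := Set.mem_mul.1 hy
  obtain ⟨q, hq, hgate⟩ := hL.exists_gate (x * h)
  exact ⟨q, hq, hH.gate_mem (by simpa using hh) (hgate x hx), hgate⟩

theorem ConvexSet.mul {L H : Set (Grp k F)} (hL : ConvexSet L) (hH : ClosedSet H) :
    ConvexSet (L * H) := by
  refine ⟨hL.1.mul hH.1.1, fun y₁ y₂ y hy₁ hy₂ hy => ?_⟩
  obtain ⟨p, hp, hpy⟩ := hL.exists_gate y
  have key : ∀ z ∈ L * H, ∃ m, Between p m y ∧ Between z m y ∧ p⁻¹ * m ∈ H := by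
    intro z hz
    obtain ⟨q, hq, hqH, hqz⟩ := exists_gate_of_mem_mul hL hH hz
    obtain ⟨m, hmy, hmz, hyz⟩ := exists_median p y z
    exact ⟨m, hmy, hyz.symm,
      hH.1.2.1 _ hqH _ (le_of_gates (hpy q hq) (hqz p hp) hmy hmz)⟩
  obtain ⟨m₁, hm₁, hm₁', hH₁⟩ := key y₁ hy₁
  obtain ⟨m₂, hm₂, hm₂', hH₂⟩ := key y₂ hy₂
  have hj := isJoin_of_between (le_inv_mul_iff_between.2 hm₁) (le_inv_mul_iff_between.2 hm₂)
    ((between_mul_left p⁻¹).2 hm₁') ((between_mul_left p⁻¹).2 hm₂')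
    ((between_mul_left p⁻¹).2 hy)
  exact ⟨p, hp, p⁻¹ * y, hH.1.2.2 _ hH₁ _ hH₂ _ hj, mul_inv_cancel_left p y⟩

theorem convexSet_singleton (x : Grp k F) : ConvexSet {x} := by
  refine ⟨Set.singleton_nonempty x, ?_⟩
  rintro _ _ y rfl rfl h
  rw [dist_self] at h
  exact (eq_of_dist_eq_zero (by omega)).symm

theorem MinimalIn.mem_image {L H : Set (Grp k F)} (hL : ConvexSet L) (hH : ClosedSet H)
    {mL m : Grp k F} (hmL : MinimalIn L mL) (hm : MinimalIn (L * H) m) :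
    m ∈ (mL * ·) '' H := by
  obtain ⟨g, hg, hgate⟩ := hL.exists_gate 1
  obtain rfl := hmL.2 g hg (le_iff_between.2 (hgate mL hmL.1).symm)
  obtain ⟨q, hq, hqH, hqm⟩ := exists_gate_of_mem_mul hL hH hm.1
  obtain ⟨n, hn, hnm, hn'⟩ := exists_median g 1 m
  have hnH : g⁻¹ * n ∈ H := hH.1.2.1 _ hqH _ (le_of_gates (hgate q hq) (hqm g hg) hn hnm)
  obtain rfl := hm.2 n ⟨g, hg, g⁻¹ * n, hnH, mul_inv_cancel_left g n⟩ (le_iff_between.2 hn')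
  exact ⟨g⁻¹ * n, hnH, mul_inv_cancel_left g n⟩

theorem MinimalIn.eq {S : Set (Grp k F)} (hS : ConvexSet S) {m₁ m₂ : Grp k F}
    (h₁ : MinimalIn S m₁) (h₂ : MinimalIn S m₂) : m₁ = m₂ := by
  obtain ⟨m, hm₁, hm₂, hm⟩ := exists_median 1 m₁ m₂
  have hmS := hS.2 m₁ m₂ m h₁.1 h₂.1 hm
  rw [← h₁.2 m hmS (le_iff_between.2 hm₁), ← h₂.2 m hmS (le_iff_between.2 hm₂)]

end Metric

end GraphGroup

/-- for convex `L` and closed `H`, `LH` is convex and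
`min(LH) = min(min(L)H)`. -/
theorem stmt10 {k : ℕ} (hk : 1 ≤ k) {F : Set (Sym2 (Fin k))}
    (L H : Set (Grp k F)) (hL : ConvexSet L) (hH : ClosedSet H) :
    ConvexSet (L * H) ∧
      ∀ mL m₁ m₂ : Grp k F, MinimalIn L mL → MinimalIn (L * H) m₁ →
        MinimalIn ((mL * ·) '' H) m₂ → m₁ = m₂ := by
  refine ⟨hL.mul hH, fun mL m₁ m₂ hmL h₁ h₂ => ?_⟩
  have hS : (mL * ·) '' H = {mL} * H := Set.singleton_mul.symm
  have hmem := hmL.mem_image hL hH h₁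
  rw [hS] at h₂ hmem
  refine MinimalIn.eq ((convexSet_singleton mL).mul hH) ⟨hmem, fun x hx => h₁.2 x ?_⟩ h₂
  exact Set.mul_subset_mul_right (Set.singleton_subset_iff.2 hmL.1) hx

end GraphGroupPaper
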